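/- arXiv:1908.06458 — 2 statements merged into one kernel-verified Lean document; each statement's English description precedes it below -/
import Mathlib

section
/- Let 0 < k ≤ 1, u > 0 and ε > 0. Then there is a constant C = C(k,u,ε) such that for every frequency λ, every x > 0 and every complex sequence (a_n): |∑_{n : λ_n < x} a_n e^{-(u+ε)λ_n} (1 − λ_n/x)^k| ≤ C · sup_{0 < y ≤ x} |e^{-uy} ∑_{n : λ_n < y} a_n (1 − λ_n/y)^k|. -/
open MeasureTheory Complex Filter Topology
open scoped ENNReal NNReal

/-- A frequency: a strictly increasing, unbounded sequence of non-negative reals. -/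
structure IsFrequency (Λ : ℕ → ℝ) : Prop where
  mono : StrictMono Λ
  nonneg : ∀ n, 0 ≤ Λ n
  unbounded : Tendsto Λ atTop atTop

open Nat in
/-- The Taylor coefficients of the kernel: `(k+1)(k+2)⋯(k+m+1) / (m+1)!`. -/
noncomputable def rieszCoeff (k : ℝ) (m : ℕ) : ℝ :=
  (∏ j ∈ Finset.range (m + 1), (k + 1 + j)) / (m + 1)!

open Nat in
/-- The kernel `G` with `(e^{sw} - 1) w^k = ∫₀ʷ z^k G(w - z) dz`. -/
noncomputable def rieszKernel (k s v : ℝ) : ℝ :=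
  ∑' m : ℕ, s * (rieszCoeff k m * ((s * v) ^ m / m !))

lemma rieszCoeff_pos {k : ℝ} (hk : 0 < k) (m : ℕ) : 0 < rieszCoeff k m := by
  unfold rieszCoeff
  have : 0 < ∏ j ∈ Finset.range (m + 1), (k + 1 + (j : ℝ)) :=
    Finset.prod_pos fun j _ => by positivity
  positivity

lemma rieszCoeff_succ (k : ℝ) (m : ℕ) :
    rieszCoeff k (m + 1) = rieszCoeff k m * ((k + m + 2) / (m + 2)) := by
  unfold rieszCoeff
  rw [Finset.prod_range_succ _ (m + 1), Nat.factorial_succ (m + 1)]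
  have := Nat.factorial_ne_zero (m + 1)
  push_cast
  field_simp
  ring

lemma rieszCoeff_le {k : ℝ} (hk : 0 < k) (hk1 : k ≤ 1) (m : ℕ) :
    rieszCoeff k m ≤ 2 * ((m : ℝ) + 1) ^ k := by
  induction m with
  | zero => simp [rieszCoeff]; linarith
  | succ m ih =>
    have hi : (0 : ℝ) < (m : ℝ) + 2 := by positivity
    have key : ((m : ℝ) + 1) ^ k * ((k + m + 2) / (m + 2)) ≤ ((m : ℝ) + 2) ^ k := by
      have hd : -1 ≤ -(1 / ((m : ℝ) + 2)) := by
        rw [neg_le_neg_iff, div_le_one hi]; linarith [(Nat.cast_nonneg m : (0 : ℝ) ≤ m)]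
      have hb := rpow_one_add_le_one_add_mul_self hd hk.le hk1
      have e : ((m : ℝ) + 1) = ((m : ℝ) + 2) * (1 + -(1 / ((m : ℝ) + 2))) := by
        field_simp; ring
      have h0 : 0 ≤ 1 + -(1 / ((m : ℝ) + 2)) := by linarith
      have e2 : (k + m + 2) / ((m : ℝ) + 2) = 1 + k * (1 / ((m : ℝ) + 2)) := by
        field_simp; ring
      rw [e, Real.mul_rpow hi.le h0, e2, mul_assoc]
      refine mul_le_of_le_one_right (by positivity) ?_
      calc _ ≤ (1 + k * -(1 / ((m : ℝ) + 2))) * (1 + k * (1 / ((m : ℝ) + 2))) := by gcongr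
        _ ≤ 1 := by nlinarith [sq_nonneg (k * (1 / ((m : ℝ) + 2)))]
    rw [rieszCoeff_succ]
    push_cast
    calc _ ≤ 2 * ((m : ℝ) + 1) ^ k * ((k + m + 2) / (m + 2)) := by gcongr
      _ ≤ 2 * ((m : ℝ) + 2) ^ k := by linarith
      _ = _ := by norm_num [add_assoc]

open Nat in
lemma hasSum_pow_div_factorial (r : ℝ) : HasSum (fun m : ℕ => r ^ m / m !) (Real.exp r) := by
  rw [Real.exp_eq_exp_ℝ]
  exact NormedSpace.expSeries_div_hasSum_exp r

open Nat in
lemma hasSum_succ_mul_pow_div_factorial (r : ℝ) :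
    HasSum (fun m : ℕ => ((m : ℝ) + 1) * (r ^ m / m !)) ((r + 1) * Real.exp r) := by
  have h : HasSum (fun m : ℕ => (m : ℝ) * (r ^ m / m !)) (r * Real.exp r) := by
    rw [← hasSum_nat_add_iff' 1]
    simp only [Finset.range_one, Finset.sum_singleton, Nat.cast_zero, zero_mul, sub_zero]
    refine (congrArg (HasSum · _) (funext fun m => ?_)).mp
      ((hasSum_pow_div_factorial r).mul_left r)
    rw [Nat.factorial_succ, pow_succ]
    push_cast
    field_simp
  simpa only [add_mul, one_mul] using h.add (hasSum_pow_div_factorial r)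

open Nat in
lemma rieszKernel_summable_and_le {k s v : ℝ} (hk : 0 < k) (hk1 : k ≤ 1) (hs : 0 < s)
    (hv : 0 ≤ v) :
    Summable (fun m : ℕ => s * (rieszCoeff k m * ((s * v) ^ m / m !))) ∧
      rieszKernel k s v ≤ 4 * s * ((s * v + 1) ^ k * Real.exp (s * v)) := by
  have hT : 0 < s * v + 1 := by positivity
  have hsum : HasSum (fun m : ℕ => 2 * s * (s * v + 1) ^ k *
      ((s * v) ^ m / m ! + ((m : ℝ) + 1) * ((s * v) ^ m / m !) / (s * v + 1)))
      (4 * s * ((s * v + 1) ^ k * Real.exp (s * v))) := by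
    have h := ((hasSum_pow_div_factorial (s * v)).add
      ((hasSum_succ_mul_pow_div_factorial (s * v)).div_const (s * v + 1))).mul_left
        (2 * s * (s * v + 1) ^ k)
    rw [mul_div_cancel_left₀ _ hT.ne'] at h
    rwa [show 4 * s * ((s * v + 1) ^ k * Real.exp (s * v)) =
      2 * s * (s * v + 1) ^ k * (Real.exp (s * v) + Real.exp (s * v)) by ring]
  have hle : ∀ m : ℕ, s * (rieszCoeff k m * ((s * v) ^ m / m !)) ≤ 2 * s * (s * v + 1) ^ k *
      ((s * v) ^ m / m ! + ((m : ℝ) + 1) * ((s * v) ^ m / m !) / (s * v + 1)) := by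
    intro m
    have h1 : ((m : ℝ) + 1) ^ k ≤ (s * v + 1) ^ k * (1 + ((m : ℝ) + 1) / (s * v + 1)) := by
      have : (((m : ℝ) + 1) / (s * v + 1)) ^ k ≤ 1 + ((m : ℝ) + 1) / (s * v + 1) := by
        set t := ((m : ℝ) + 1) / (s * v + 1) with ht
        have ht0 : 0 ≤ t := by positivity
        calc t ^ k ≤ (1 + t) ^ k := by gcongr; linarith
          _ ≤ (1 + t) ^ (1 : ℝ) := Real.rpow_le_rpow_of_exponent_le (by linarith) hk1
          _ = 1 + t := Real.rpow_one _
      rw [Real.div_rpow (by positivity) hT.le, div_le_iff₀ (by positivity)] at this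
      linarith
    have h2 : rieszCoeff k m ≤ 2 * ((s * v + 1) ^ k * (1 + ((m : ℝ) + 1) / (s * v + 1))) :=
      (rieszCoeff_le hk hk1 m).trans (by linarith)
    calc _ ≤ s * (2 * ((s * v + 1) ^ k * (1 + ((m : ℝ) + 1) / (s * v + 1))) *
          ((s * v) ^ m / m !)) := by gcongr
      _ = _ := by ring
  have hS := Summable.of_nonneg_of_le (fun m => by
    have := (rieszCoeff_pos hk m).le
    positivity) hle hsum.summable
  exact ⟨hS, (hS.tsum_le_tsum hle hsum.summable).trans_eq hsum.tsum_eq⟩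

lemma rieszKernel_nonneg {k s v : ℝ} (hk : 0 < k) (hs : 0 < s) (hv : 0 ≤ v) :
    0 ≤ rieszKernel k s v :=
  tsum_nonneg fun m => by
    have := (rieszCoeff_pos hk m).le
    positivity

lemma rieszKernel_monotoneOn {k s : ℝ} (hk : 0 < k) (hk1 : k ≤ 1) (hs : 0 < s) :
    MonotoneOn (rieszKernel k s) (Set.Ici 0) := by
  intro v hv w hw hvw
  have hv : 0 ≤ v := hv
  refine Summable.tsum_le_tsum (fun m => ?_) (rieszKernel_summable_and_le hk hk1 hs hv).1
    (rieszKernel_summable_and_le hk hk1 hs hw).1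
  have := (rieszCoeff_pos hk m).le
  gcongr

open Nat in
lemma integral_rpow_mul_sub_pow {k w : ℝ} (hk : 0 < k) (hw : 0 < w) (m : ℕ) :
    ∫ z in 0..w, z ^ k * (w - z) ^ m =
      w ^ k * w ^ (m + 1) * (m ! / ∏ j ∈ Finset.range (m + 1), (k + 1 + j)) := by
  have h := Complex.betaIntegral_scaled (k + 1) (m + 1) hw
  rw [Complex.betaIntegral_eval_nat_add_one_right (by simp; linarith)] at h
  have e : ∫ z in 0..w, (z : ℂ) ^ ((k : ℂ) + 1 - 1) * ((w : ℂ) - z) ^ ((m : ℂ) + 1 - 1) =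
      ((∫ z in 0..w, z ^ k * (w - z) ^ m : ℝ) : ℂ) := by
    rw [← intervalIntegral.integral_ofReal]
    refine intervalIntegral.integral_congr fun z hz => ?_
    rw [Set.uIcc_of_le hw.le] at hz
    simp only [add_sub_cancel_right, Complex.cpow_natCast]
    push_cast
    rw [Complex.ofReal_cpow hz.1]
  rw [e] at h
  apply Complex.ofReal_injective
  rw [h]
  have e2 : (k : ℂ) + 1 + (m + 1) - 1 = ((k + (m + 1 : ℕ) : ℝ) : ℂ) := by push_cast; ring
  rw [e2, ← Complex.ofReal_cpow hw.le, Real.rpow_add hw, Real.rpow_natCast]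
  push_cast
  rfl

open Nat in
lemma integral_rpow_mul_rieszKernel {k s w : ℝ} (hk : 0 < k) (hs : 0 < s) (hw : 0 < w) :
    ∫ z in 0..w, z ^ k * rieszKernel k s (w - z) = (Real.exp (s * w) - 1) * w ^ k := by
  have hval : ∀ m : ℕ, ∫ z in 0..w, z ^ k * (s * (rieszCoeff k m * ((s * (w - z)) ^ m / m !))) =
      w ^ k * ((s * w) ^ (m + 1) / (m + 1)!) := by
    intro m
    have : ∀ z : ℝ, z ^ k * (s * (rieszCoeff k m * ((s * (w - z)) ^ m / m !))) =
        s ^ (m + 1) * rieszCoeff k m / m ! * (z ^ k * (w - z) ^ m) := by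
      intro z; rw [mul_pow]; ring
    simp_rw [this]
    rw [intervalIntegral.integral_const_mul, integral_rpow_mul_sub_pow hk hw, rieszCoeff, mul_pow]
    have h1 : ∏ j ∈ Finset.range (m + 1), (k + 1 + (j : ℝ)) ≠ 0 :=
      (Finset.prod_pos fun j _ => by positivity).ne'
    have h2 := Nat.factorial_ne_zero m
    have h3 := Nat.factorial_ne_zero (m + 1)
    field_simp
  have hexp : HasSum (fun m : ℕ => w ^ k * ((s * w) ^ (m + 1) / (m + 1)!))
      (w ^ k * (Real.exp (s * w) - 1)) := by
    have := (hasSum_nat_add_iff' 1).2 (hasSum_pow_div_factorial (s * w))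
    simpa using this.mul_left (w ^ k)
  simp only [intervalIntegral.integral_of_le hw.le] at hval ⊢
  have key := hasSum_integral_of_summable_integral_norm
    (μ := volume.restrict (Set.Ioc 0 w))
    (F := fun (m : ℕ) (z : ℝ) => z ^ k * (s * (rieszCoeff k m * ((s * (w - z)) ^ m / m !))))
    (fun m => by
      refine (Continuous.integrableOn_Ioc ?_)
      have := Real.continuous_rpow_const hk.le
      fun_prop) (by
      refine hexp.summable.congr fun m => ?_
      rw [← hval m]
      refine setIntegral_congr_fun measurableSet_Ioc fun z hz => ?_
      have := (rieszCoeff_pos hk m).le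
      have h1 : 0 ≤ w - z := sub_nonneg.2 hz.2
      have h2 := hz.1.le
      exact (Real.norm_of_nonneg (by positivity)).symm)
  simp only [hval] at key
  rw [mul_comm (_ - _), ← key.unique hexp]
  simp only [tsum_mul_left, rieszKernel]

lemma intervalIntegrable_rieszKernel_sub {k s a b x : ℝ} (hk : 0 < k) (hk1 : k ≤ 1) (hs : 0 < s)
    (ha : a ≤ x) (hb : b ≤ x) :
    IntervalIntegrable (fun y => rieszKernel k s (x - y)) volume a b := by
  refine AntitoneOn.intervalIntegrable fun y hy z hz hyz => ?_
  have hz' : z ≤ x := (Set.mem_uIcc.1 hz).elim (fun h => h.2.trans hb) (fun h => h.2.trans ha)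
  exact rieszKernel_monotoneOn hk hk1 hs (sub_nonneg.2 hz') (sub_nonneg.2 (hyz.trans hz'))
    (by linarith)

lemma exp_mul_rpow_eq_add_integral {k s l x : ℝ} (hk : 0 < k) (hk1 : k ≤ 1) (hs : 0 < s)
    (hl : 0 ≤ l) (hlx : l < x) :
    Real.exp (-(s * l)) * max (x - l) 0 ^ k = Real.exp (-(s * x)) *
      (max (x - l) 0 ^ k + ∫ y in 0..x, rieszKernel k s (x - y) * max (y - l) 0 ^ k) := by
  have hcont : Continuous fun y : ℝ => max (y - l) 0 ^ k := by
    have := Real.continuous_rpow_const hk.le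
    fun_prop
  have hint : ∀ a b : ℝ, a ≤ x → b ≤ x →
      IntervalIntegrable (fun y => rieszKernel k s (x - y) * max (y - l) 0 ^ k) volume a b :=
    fun a b ha hb => (intervalIntegrable_rieszKernel_sub hk hk1 hs ha hb).mul_continuousOn
      hcont.continuousOn
  have h0 : ∫ y in 0..l, rieszKernel k s (x - y) * max (y - l) 0 ^ k = 0 := by
    refine (intervalIntegral.integral_congr (g := fun _ => 0) fun y hy => ?_).trans
      intervalIntegral.integral_zero
    rw [Set.uIcc_of_le hl] at hy
    simp only [max_eq_right (sub_nonpos.2 hy.2), Real.zero_rpow hk.ne', mul_zero]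
  have h1 : ∫ y in l..x, rieszKernel k s (x - y) * max (y - l) 0 ^ k =
      (Real.exp (s * (x - l)) - 1) * (x - l) ^ k := by
    have hsub := intervalIntegral.integral_comp_sub_right (a := l) (b := x)
      (fun z => z ^ k * rieszKernel k s (x - l - z)) l
    rw [sub_self] at hsub
    rw [← integral_rpow_mul_rieszKernel hk hs (sub_pos.2 hlx), ← hsub]
    refine intervalIntegral.integral_congr fun y hy => ?_
    rw [Set.uIcc_of_le hlx.le] at hy
    simp only [max_eq_left (sub_nonneg.2 hy.1), sub_sub_sub_cancel_right]
    exact mul_comm _ _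
  rw [← intervalIntegral.integral_add_adjacent_intervals (hint 0 l (hl.trans hlx.le) hlx.le)
    (hint l x hlx.le le_rfl), h0, h1, max_eq_left (sub_nonneg.2 hlx.le),
    show -(s * l) = -(s * x) + s * (x - l) by ring, Real.exp_add]
  ring

lemma integral_mul_add_one_mul_exp_neg_le {s ε x : ℝ} (hs : 0 < s) (hε : 0 < ε) (hx : 0 ≤ x) :
    ∫ y in 0..x, (s * y + 1) * Real.exp (-(ε * y)) ≤ 1 / ε + s / ε ^ 2 := by
  have hd : ∀ y ∈ Set.uIcc 0 x, HasDerivAt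
      (fun y => -((s * y + 1) / ε + s / ε ^ 2) * Real.exp (-(ε * y)))
      ((s * y + 1) * Real.exp (-(ε * y))) y := by
    intro y _
    have h1 : HasDerivAt (fun y : ℝ => -((s * y + 1) / ε + s / ε ^ 2)) (-(s / ε)) y := by
      have h := (((((hasDerivAt_id y).const_mul s).add_const 1).div_const ε).add_const
        (s / ε ^ 2)).neg
      rwa [mul_one] at h
    have h2 : HasDerivAt (fun y : ℝ => Real.exp (-(ε * y))) (Real.exp (-(ε * y)) * -ε) y := by
      simpa using ((hasDerivAt_id y).const_mul ε).neg.exp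
    refine (h1.mul h2).congr_deriv ?_
    field_simp
    ring
  rw [intervalIntegral.integral_eq_sub_of_hasDerivAt hd
    (Continuous.intervalIntegrable (by fun_prop) _ _)]
  have : 0 ≤ ((s * x + 1) / ε + s / ε ^ 2) * Real.exp (-(ε * x)) := by positivity
  simp only [mul_zero, neg_zero, Real.exp_zero, zero_add]
  linarith

/-- The kernel `y ↦ e^{-sx} G(x - y)` weighted by `y^k e^{uy}` is dominated by an integrable
function, up to the factor `x^k`. -/
lemma rieszKernel_mul_weight_le {k s u ε x y : ℝ} (hk : 0 < k) (hk1 : k ≤ 1) (hs : 0 < s)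
    (hsu : s = u + ε) (hy : 0 < y) (hyx : y ≤ x) :
    rieszKernel k s (x - y) * (y ^ k * Real.exp (u * y)) ≤
      4 * s * x ^ k * Real.exp (s * x) * ((s * y + 1) * Real.exp (-(ε * y))) := by
  have hxy : 0 ≤ x - y := sub_nonneg.2 hyx
  have hx : 0 < x := hy.trans_le hyx
  have hpow : (s * (x - y) + 1) ^ k * y ^ k ≤ x ^ k * (s * y + 1) := by
    rw [← Real.mul_rpow (by positivity) hy.le]
    calc ((s * (x - y) + 1) * y) ^ k ≤ (x * (s * y + 1)) ^ k := by
          refine Real.rpow_le_rpow (by positivity) ?_ hk.le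
          nlinarith [mul_pos hs (mul_pos hy hy)]
      _ = x ^ k * (s * y + 1) ^ k := Real.mul_rpow hx.le (by positivity)
      _ ≤ x ^ k * (s * y + 1) ^ (1 : ℝ) := by
          gcongr
          nlinarith [mul_pos hs hy]
      _ = _ := by rw [Real.rpow_one]
  have hexp : Real.exp (s * (x - y)) * Real.exp (u * y) =
      Real.exp (s * x) * Real.exp (-(ε * y)) := by
    rw [← Real.exp_add, ← Real.exp_add, hsu]
    ring_nf
  calc _ ≤ 4 * s * ((s * (x - y) + 1) ^ k * Real.exp (s * (x - y))) *
        (y ^ k * Real.exp (u * y)) := by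
        gcongr
        exact (rieszKernel_summable_and_le hk hk1 hs hxy).2
    _ = 4 * s * ((s * (x - y) + 1) ^ k * y ^ k) *
        (Real.exp (s * (x - y)) * Real.exp (u * y)) := by ring
    _ ≤ 4 * s * (x ^ k * (s * y + 1)) * (Real.exp (s * x) * Real.exp (-(ε * y))) := by
        rw [hexp]
        gcongr
    _ = _ := by ring

lemma norm_sum_exp_mul_rpow_le {ι : Type*} {k u ε x M : ℝ} (hk : 0 < k) (hk1 : k ≤ 1)
    (hu : 0 < u) (hε : 0 < ε) (hx : 0 < x) (hM : 0 ≤ M) (F : Finset ι) (l : ι → ℝ)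
    (hl : ∀ n ∈ F, 0 ≤ l n ∧ l n < x) (a : ι → ℂ)
    (hS : ∀ y, 0 < y → y ≤ x →
      ‖∑ n ∈ F, a n * ((max (y - l n) 0 ^ k : ℝ) : ℂ)‖ ≤ M * (y ^ k * Real.exp (u * y))) :
    ‖∑ n ∈ F, a n * ((Real.exp (-((u + ε) * l n)) * max (x - l n) 0 ^ k : ℝ) : ℂ)‖ ≤
      (1 + 4 * (u + ε) * (1 / ε + (u + ε) / ε ^ 2)) * M * x ^ k := by
  obtain ⟨s, hsu⟩ : ∃ s, s = u + ε := ⟨_, rfl⟩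
  rw [← hsu]
  have hs : 0 < s := by linarith
  set S : ℝ → ℂ := fun y => ∑ n ∈ F, a n * ((max (y - l n) 0 ^ k : ℝ) : ℂ) with hSdef
  have hrep : ∑ n ∈ F, a n * ((Real.exp (-(s * l n)) * max (x - l n) 0 ^ k : ℝ) : ℂ) =
      (Real.exp (-(s * x)) : ℂ) * (S x + ∫ y in 0..x, (rieszKernel k s (x - y) : ℂ) * S y) := by
    have hint : ∫ y in 0..x, (rieszKernel k s (x - y) : ℂ) * S y = ∑ n ∈ F, a n *
        ((∫ y in 0..x, rieszKernel k s (x - y) * max (y - l n) 0 ^ k : ℝ) : ℂ) := by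
      have e : ∀ y, (rieszKernel k s (x - y) : ℂ) * S y = ∑ n ∈ F, a n *
          ((rieszKernel k s (x - y) * max (y - l n) 0 ^ k : ℝ) : ℂ) := by
        intro y
        rw [hSdef, Finset.mul_sum]
        refine Finset.sum_congr rfl fun n _ => ?_
        push_cast
        ring
      simp_rw [e]
      rw [intervalIntegral.integral_finsetSum]
      · simp_rw [intervalIntegral.integral_const_mul, intervalIntegral.integral_ofReal]
      · intro n _
        have hc : Continuous fun y : ℝ => max (y - l n) 0 ^ k := by
          have := Real.continuous_rpow_const hk.le
          fun_prop
        have hi := (intervalIntegrable_rieszKernel_sub hk hk1 hs hx.le le_rfl).mul_continuousOn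
          hc.continuousOn
        exact IntervalIntegrable.const_mul ⟨hi.1.ofReal, hi.2.ofReal⟩ (a n)
    rw [hint, hSdef, ← Finset.sum_add_distrib, Finset.mul_sum]
    refine Finset.sum_congr rfl fun n hn => ?_
    rw [exp_mul_rpow_eq_add_integral hk hk1 hs (hl n hn).1 (hl n hn).2]
    push_cast
    ring
  have hI : ‖∫ y in 0..x, (rieszKernel k s (x - y) : ℂ) * S y‖ ≤
      M * (4 * s * x ^ k * Real.exp (s * x)) * (1 / ε + s / ε ^ 2) := by
    refine (intervalIntegral.norm_integral_le_of_norm_le hx.le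
      (g := fun y => M * (4 * s * x ^ k * Real.exp (s * x)) *
        ((s * y + 1) * Real.exp (-(ε * y)))) (ae_of_all _ fun y hy => ?_)
      (Continuous.intervalIntegrable (by fun_prop) _ _)).trans ?_
    · have h0 := rieszKernel_nonneg hk hs (sub_nonneg.2 hy.2)
      rw [norm_mul, Complex.norm_real, Real.norm_of_nonneg h0]
      calc _ ≤ rieszKernel k s (x - y) * (M * (y ^ k * Real.exp (u * y))) := by
            gcongr
            exact hS y hy.1 hy.2
        _ = M * (rieszKernel k s (x - y) * (y ^ k * Real.exp (u * y))) := by ring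
        _ ≤ M * (4 * s * x ^ k * Real.exp (s * x) * ((s * y + 1) * Real.exp (-(ε * y)))) := by
            exact mul_le_mul_of_nonneg_left
              (rieszKernel_mul_weight_le hk hk1 hs hsu hy.1 hy.2) hM
        _ = _ := by ring
    · rw [intervalIntegral.integral_const_mul]
      gcongr
      exact integral_mul_add_one_mul_exp_neg_le hs hε hx.le
  have hSx : ‖S x‖ ≤ M * x ^ k * Real.exp (s * x) := by
    refine (hS x hx le_rfl).trans ?_
    rw [← mul_assoc]
    gcongr
    linarith
  rw [hrep, norm_mul, Complex.norm_real, Real.norm_of_nonneg (Real.exp_pos _).le]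
  calc _ ≤ Real.exp (-(s * x)) * (M * x ^ k * Real.exp (s * x) +
        M * (4 * s * x ^ k * Real.exp (s * x)) * (1 / ε + s / ε ^ 2)) := by
        gcongr
        exact (norm_add_le _ _).trans (add_le_add hSx hI)
    _ = (Real.exp (-(s * x)) * Real.exp (s * x)) *
        ((1 + 4 * s * (1 / ε + s / ε ^ 2)) * M * x ^ k) := by ring
    _ = _ := by rw [← Real.exp_add, neg_add_cancel, Real.exp_zero, one_mul]

/-- Riesz sums over `λ_n < y`, `y ≤ x`, as finite sums over a fixed index set. -/
lemma tsum_riesz_eq_sum {ι : Type*} {k x y : ℝ} (hk : 0 < k) (hy : 0 < y) (hyx : y ≤ x)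
    (F : Finset ι) (l : ι → ℝ) (hF : ∀ n, n ∈ F ↔ l n < x) (a : ι → ℂ) (c : ι → ℝ) :
    ∑' n, (if l n < y then a n * ((c n * (1 - l n / y) ^ k : ℝ) : ℂ) else 0) =
      (∑ n ∈ F, a n * ((c n * max (y - l n) 0 ^ k : ℝ) : ℂ)) / ((y ^ k : ℝ) : ℂ) := by
  rw [tsum_eq_sum (s := F), Finset.sum_div]
  · refine Finset.sum_congr rfl fun n _ => ?_
    split_ifs with h
    · rw [max_eq_left (sub_nonneg.2 h.le), one_sub_div hy.ne',
        Real.div_rpow (sub_nonneg.2 h.le) hy.le]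
      push_cast
      ring
    · rw [max_eq_right (sub_nonpos.2 (not_lt.1 h)), Real.zero_rpow hk.ne']
      simp
  · intro n hn
    rw [if_neg fun h => hn ((hF n).2 (h.trans_le hyx))]

/-- Abel-type bound for translated first Riesz means: for `0 < k ≤ 1`,
`u > 0`, `ε > 0` there is `C = C(k,u,ε)` such that for every frequency `λ`, every `x > 0`
and every complex sequence `(a_n)`,
`|∑_{λ_n<x} a_n e^{-(u+ε)λ_n}(1 − λ_n/x)^k| ≤ C sup_{0<y≤x} |e^{-uy} ∑_{λ_n<y} a_n (1 − λ_n/y)^k|`. -/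
theorem riesz_abel_translation_bound_first
    (k u ε : ℝ) (hk0 : 0 < k) (hk1 : k ≤ 1) (hu : 0 < u) (hε : 0 < ε) :
    ∃ C : ℝ, 0 < C ∧ ∀ (Λ : ℕ → ℝ), IsFrequency Λ → ∀ x : ℝ, 0 < x → ∀ a : ℕ → ℂ,
      (‖∑' n : ℕ, if Λ n < x then
            a n * ((Real.exp (-((u + ε) * Λ n)) * (1 - Λ n / x) ^ k : ℝ) : ℂ)
          else 0‖₊ : ℝ≥0∞) ≤
        ENNReal.ofReal C * ⨆ (y : ℝ) (_ : 0 < y) (_ : y ≤ x),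
          (‖(Real.exp (-(u * y)) : ℂ) *
              ∑' n : ℕ, if Λ n < y then a n * (((1 - Λ n / y) ^ k : ℝ) : ℂ) else 0‖₊ : ℝ≥0∞) := by
  have hC : 0 < 1 + 4 * (u + ε) * (1 / ε + (u + ε) / ε ^ 2) := by positivity
  refine ⟨_, hC, fun Λ hΛ x hx a => ?_⟩
  have hfin : {n | Λ n < x}.Finite := by
    have h := hΛ.unbounded.eventually_ge_atTop x
    rw [← Nat.cofinite_eq_atTop, eventually_cofinite] at h
    simpa only [not_le] using h
  set F := hfin.toFinset
  have hF : ∀ n, n ∈ F ↔ Λ n < x := fun n => hfin.mem_toFinset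
  set B := ⨆ (y : ℝ) (_ : 0 < y) (_ : y ≤ x), (‖(Real.exp (-(u * y)) : ℂ) *
    ∑' n : ℕ, if Λ n < y then a n * (((1 - Λ n / y) ^ k : ℝ) : ℂ) else 0‖₊ : ℝ≥0∞) with hB
  rcases eq_or_ne B ⊤ with hBt | hBt
  · rw [hBt, ENNReal.mul_top (ENNReal.ofReal_pos.2 hC).ne']
    exact le_top
  have hS : ∀ y, 0 < y → y ≤ x → ‖∑ n ∈ F, a n * ((max (y - Λ n) 0 ^ k : ℝ) : ℂ)‖ ≤
      B.toReal * (y ^ k * Real.exp (u * y)) := by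
    intro y hy hyx
    have h1 := le_iSup₂_of_le (f := fun (y : ℝ) (_ : 0 < y) => ⨆ (_ : y ≤ x),
      (‖(Real.exp (-(u * y)) : ℂ) * ∑' n : ℕ, if Λ n < y then
        a n * (((1 - Λ n / y) ^ k : ℝ) : ℂ) else 0‖₊ : ℝ≥0∞)) y hy (le_iSup_of_le hyx le_rfl)
    rw [← hB] at h1
    have h2 := ENNReal.toReal_mono hBt h1
    have h3 := tsum_riesz_eq_sum hk0 hy hyx F Λ hF a (fun _ => 1)
    simp only [one_mul] at h3
    rw [h3, ENNReal.coe_toReal, coe_nnnorm, norm_mul, norm_div, Complex.norm_real,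
      Complex.norm_real, Real.norm_of_nonneg (Real.exp_pos _).le,
      Real.norm_of_nonneg (by positivity : 0 ≤ y ^ k), Real.exp_neg, ← div_eq_inv_mul, div_div,
      div_le_iff₀ (by positivity)] at h2
    exact h2
  have hmain := norm_sum_exp_mul_rpow_le hk0 hk1 hu hε hx ENNReal.toReal_nonneg F Λ
    (fun n hn => ⟨hΛ.nonneg n, (hF n).1 hn⟩) a hS
  rw [tsum_riesz_eq_sum hk0 hx le_rfl F Λ hF a, ← ENNReal.ofReal_toReal hBt,
    ← ENNReal.ofReal_mul hC.le, ← enorm_eq_nnnorm, ← ofReal_norm]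
  refine ENNReal.ofReal_le_ofReal ?_
  rw [norm_div, Complex.norm_real, Real.norm_of_nonneg (by positivity : 0 ≤ x ^ k),
    div_le_iff₀ (by positivity)]
  exact hmain
end

section
/- Let 0 < k ≤ 1, u > 0 and ε > 0. Then there is a constant C = C(k,u,ε) such that for every frequency λ, every x > 0 and every complex sequence (a_n): |∑_{n : λ_n < x} a_n e^{-(u+ε)λ_n} (1 − e^{λ_n − x})^k| ≤ C · sup_{0 < y ≤ x} |e^{-uy} ∑_{n : λ_n < y} a_n (1 − λ_n/y)^k|. -/
open MeasureTheory Complex Filter Topology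
open scoped ENNReal NNReal

/-- The convolution `t_+ ^ (-k) * t_+ ^ k` of truncated powers is a multiple of `t_+`. -/
lemma exists_integral_rpow_mul_posPart_rpow {k : ℝ} (hk0 : 0 < k) (hk1 : k < 1) :
    ∃ B : ℝ, 0 < B ∧ ∀ l y : ℝ, 0 ≤ l → 0 ≤ y →
      ∫ r in (0 : ℝ)..y, (y - r) ^ (-k) * (max (r - l) 0) ^ k = B * max (y - l) 0 := by
  have hker : ∀ y : ℝ, IntervalIntegrable (fun r : ℝ => (y - r) ^ (-k)) volume 0 y := by
    intro y
    have h := (intervalIntegral.intervalIntegrable_rpow' (a := y) (b := 0)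
      (r := -k) (by linarith)).comp_sub_left y
    simpa using h
  have hcont : ∀ l : ℝ, Continuous fun r : ℝ => (max (r - l) 0) ^ k := fun l =>
    Continuous.rpow_const (by fun_prop) fun _ => Or.inr hk0.le
  have hzero : ∀ l y b : ℝ, b ≤ l → 0 ≤ b →
      ∫ r in (0 : ℝ)..b, (y - r) ^ (-k) * (max (r - l) 0) ^ k = 0 := by
    intro l y b hb h0
    rw [intervalIntegral.integral_congr (g := fun _ => (0 : ℝ))]
    · simp
    · intro r hr
      rw [Set.uIcc_of_le h0] at hr
      have : max (r - l) 0 = 0 := max_eq_right (by linarith [hr.2])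
      simp [this, Real.zero_rpow hk0.ne']
  refine ⟨∫ t in (0 : ℝ)..1, (1 - t) ^ (-k) * t ^ k, ?_, ?_⟩
  · apply intervalIntegral.intervalIntegral_pos_of_pos_on _ _ one_pos
    · exact (hker 1).mul_continuousOn
        (Continuous.continuousOn (Continuous.rpow_const continuous_id fun _ => Or.inr hk0.le))
    · intro t ht
      have := Real.rpow_pos_of_pos (sub_pos.2 ht.2) (-k)
      have := Real.rpow_pos_of_pos ht.1 k
      positivity
  · intro l y hl hy
    rcases le_or_gt y l with h | h
    · rw [hzero l y y h hy, max_eq_right (by linarith), mul_zero]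
    · have hint : IntervalIntegrable
          (fun r : ℝ => (y - r) ^ (-k) * (max (r - l) 0) ^ k) volume 0 y :=
        (hker y).mul_continuousOn (hcont l).continuousOn
      have hd : 0 < y - l := sub_pos.2 h
      rw [← intervalIntegral.integral_add_adjacent_intervals (b := l)
        (hint.mono_set (by
          rw [Set.uIcc_of_le hl, Set.uIcc_of_le hy]; exact Set.Icc_subset_Icc_right h.le))
        (hint.mono_set (by
          rw [Set.uIcc_of_le h.le, Set.uIcc_of_le hy]; exact Set.Icc_subset_Icc_left hl)),
        hzero l y l le_rfl hl, zero_add, max_eq_left hd.le]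
      have hsub := intervalIntegral.smul_integral_comp_add_mul (a := 0) (b := 1)
        (fun r : ℝ => (y - r) ^ (-k) * (max (r - l) 0) ^ k) (y - l) l
      rw [show l + (y - l) * 0 = l by ring, show l + (y - l) * 1 = y by ring] at hsub
      rw [← hsub, smul_eq_mul, mul_comm]
      congr 1
      apply intervalIntegral.integral_congr
      intro t ht
      rw [Set.uIcc_of_le zero_le_one] at ht
      have h1 : y - (l + (y - l) * t) = (y - l) * (1 - t) := by ring
      have h2 : max (l + (y - l) * t - l) 0 = (y - l) * t := by
        rw [max_eq_left (by nlinarith [ht.1])]; ring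
      simp only [h1, h2]
      rw [Real.mul_rpow hd.le (by linarith [ht.2]), Real.mul_rpow hd.le ht.1,
        Real.rpow_neg hd.le]
      have := (Real.rpow_pos_of_pos hd k).ne'
      field_simp

lemma sum_mul_integral_eq (N : Finset ℕ) (a : ℕ → ℂ) (ψ : ℝ → ℝ) (f : ℕ → ℝ → ℝ) (y : ℝ)
    (hint : ∀ n ∈ N, IntervalIntegrable (fun r => ψ r * f n r) volume 0 y) :
    ∑ n ∈ N, a n * ((∫ r in (0 : ℝ)..y, ψ r * f n r : ℝ) : ℂ) =
      ∫ r in (0 : ℝ)..y, (ψ r : ℂ) * ∑ n ∈ N, a n * (f n r : ℂ) := by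
  simp_rw [Finset.mul_sum]
  rw [intervalIntegral.integral_finsetSum]
  · refine Finset.sum_congr rfl fun n _ => ?_
    rw [← intervalIntegral.integral_ofReal, ← intervalIntegral.integral_const_mul]
    congr 1; ext r; push_cast; ring
  · intro n hn
    have h : IntervalIntegrable (fun r => ((ψ r * f n r : ℝ) : ℂ)) volume 0 y :=
      ⟨(hint n hn).1.ofReal, (hint n hn).2.ofReal⟩
    convert h.const_mul (a n) using 2
    push_cast; ring

lemma intervalIntegrable_rpow_mul_exp {p b : ℝ} (hp : -1 < p) (x : ℝ) :
    IntervalIntegrable (fun v : ℝ => v ^ p * Real.exp (-b * v)) volume 0 x :=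
  (intervalIntegral.intervalIntegrable_rpow' hp).mul_continuousOn
    (Continuous.continuousOn (by fun_prop))

lemma exists_integral_rpow_mul_exp_le {p b : ℝ} (hp : -1 < p) (hb : 0 < b) :
    ∃ D : ℝ, 0 ≤ D ∧ ∀ x : ℝ, 0 ≤ x →
      ∫ v in (0 : ℝ)..x, v ^ p * Real.exp (-b * v) ≤ D := by
  have hnn : ∀ᵐ v ∂(volume.restrict (Set.Ioi (0 : ℝ))), 0 ≤ v ^ p * Real.exp (-b * v) := by
    filter_upwards [self_mem_ae_restrict measurableSet_Ioi] with v hv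
    have := Real.rpow_nonneg (le_of_lt hv) p
    positivity
  have hint : IntegrableOn (fun v : ℝ => v ^ p * Real.exp (-b * v)) (Set.Ioi 0) := by
    simpa using integrableOn_rpow_mul_exp_neg_mul_rpow hp one_pos hb
  refine ⟨∫ v in Set.Ioi (0 : ℝ), v ^ p * Real.exp (-b * v), integral_nonneg_of_ae hnn, ?_⟩
  intro x hx
  rw [intervalIntegral.integral_of_le hx]
  exact setIntegral_mono_set hint hnn (Set.Ioc_subset_Ioi_self.eventuallyLE)

/-- Exponential growth of the Riesz sums of order `k` passes to those of order `1`. -/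
lemma exists_norm_riesz_one_le {k w : ℝ} (hk0 : 0 < k) (hk1 : k ≤ 1) (hw : 0 < w) :
    ∃ D : ℝ, 0 ≤ D ∧ ∀ (N : Finset ℕ) (Λ : ℕ → ℝ) (a : ℕ → ℂ) (x K : ℝ), (∀ n, 0 ≤ Λ n) →
      (∀ y, 0 ≤ y → y ≤ x →
        ‖∑ n ∈ N, a n * (((max (y - Λ n) 0) ^ k : ℝ) : ℂ)‖ ≤ K * Real.exp (w * y)) →
      ∀ y, 0 ≤ y → y ≤ x →
        ‖∑ n ∈ N, a n * ((max (y - Λ n) 0 : ℝ) : ℂ)‖ ≤ D * K * Real.exp (w * y) := by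
  rcases hk1.eq_or_lt with rfl | hk1
  · refine ⟨1, zero_le_one, fun N Λ a x K _ h y hy hyx => ?_⟩
    simpa using h y hy hyx
  obtain ⟨B, hB, hker⟩ := exists_integral_rpow_mul_posPart_rpow hk0 hk1
  obtain ⟨D, hD, hexp⟩ := exists_integral_rpow_mul_exp_le (p := -k) (by linarith) hw
  refine ⟨D / B, by positivity, fun N Λ a x K hΛ h y hy hyx => ?_⟩
  have hK : 0 ≤ K := by
    have := (norm_nonneg _).trans (h 0 le_rfl (hy.trans hyx))
    simpa using this
  have hpow : IntervalIntegrable (fun r : ℝ => (y - r) ^ (-k)) volume 0 y := by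
    simpa using (intervalIntegral.intervalIntegrable_rpow' (a := y) (b := 0)
      (r := -k) (by linarith)).comp_sub_left y
  have hrep : (B : ℂ) * ∑ n ∈ N, a n * ((max (y - Λ n) 0 : ℝ) : ℂ) =
      ∫ r in (0 : ℝ)..y, (((y - r) ^ (-k) : ℝ) : ℂ) *
        ∑ n ∈ N, a n * (((max (r - Λ n) 0) ^ k : ℝ) : ℂ) := by
    rw [← sum_mul_integral_eq N a (fun r => (y - r) ^ (-k))
      (fun n r => (max (r - Λ n) 0) ^ k) y, Finset.mul_sum]
    · refine Finset.sum_congr rfl fun n _ => ?_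
      rw [hker (Λ n) y (hΛ n) hy]; push_cast; ring
    · intro n _
      exact hpow.mul_continuousOn (Continuous.continuousOn
        (Continuous.rpow_const (by fun_prop) fun _ => Or.inr hk0.le))
  have hbound : ‖(B : ℂ) * ∑ n ∈ N, a n * ((max (y - Λ n) 0 : ℝ) : ℂ)‖ ≤
      ∫ r in (0 : ℝ)..y, (y - r) ^ (-k) * (K * Real.exp (w * r)) := by
    rw [hrep]
    refine intervalIntegral.norm_integral_le_of_norm_le hy (ae_of_all _ fun r hr => ?_)
      (hpow.mul_continuousOn (Continuous.continuousOn (by fun_prop)))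
    have hnn := Real.rpow_nonneg (sub_nonneg.2 hr.2) (-k)
    rw [norm_mul, Complex.norm_real, Real.norm_of_nonneg hnn]
    exact mul_le_mul_of_nonneg_left (h r hr.1.le (hr.2.trans hyx)) hnn
  have hval : ∫ r in (0 : ℝ)..y, (y - r) ^ (-k) * (K * Real.exp (w * r)) =
      K * Real.exp (w * y) * ∫ v in (0 : ℝ)..y, v ^ (-k) * Real.exp (-w * v) := by
    have h1 := intervalIntegral.integral_comp_sub_left (a := 0) (b := y)
      (fun v : ℝ => v ^ (-k) * Real.exp (-w * v)) y
    rw [sub_self, sub_zero] at h1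
    rw [← h1, ← intervalIntegral.integral_const_mul]
    congr 1; ext r
    have : Real.exp (w * r) = Real.exp (w * y) * Real.exp (-w * (y - r)) := by
      rw [← Real.exp_add]; congr 1; ring
    rw [this]; ring
  rw [hval, norm_mul, Complex.norm_real, Real.norm_of_nonneg hB.le] at hbound
  have h2 := mul_le_mul_of_nonneg_left (hexp y hy)
    (mul_nonneg hK (Real.exp_pos (w * y)).le)
  rw [show D / B * K * Real.exp (w * y) = K * Real.exp (w * y) * D / B by ring,
    le_div_iff₀ hB, mul_comm]
  exact hbound.trans h2

lemma one_sub_exp_neg_pos {v : ℝ} (hv : 0 < v) : 0 < 1 - Real.exp (-v) :=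
  sub_pos.2 (Real.exp_lt_one_iff.2 (by linarith))

lemma one_sub_exp_neg_le (v : ℝ) : 1 - Real.exp (-v) ≤ v := by
  linarith [Real.add_one_le_exp (-v)]

lemma exp_neg_mul_rpow_bounds {v q j : ℝ} (hv : 0 < v) (hq : 0 ≤ q) (hqj : q ≤ j) :
    Real.exp (-(j * v)) * v ^ (-q) ≤ Real.exp (-(j * v)) * (1 - Real.exp (-v)) ^ (-q) ∧
      Real.exp (-(j * v)) * (1 - Real.exp (-v)) ^ (-q) ≤ v ^ (-q) := by
  have hw := one_sub_exp_neg_pos hv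
  constructor
  · exact mul_le_mul_of_nonneg_left
      (Real.rpow_le_rpow_of_nonpos hw (one_sub_exp_neg_le v) (by linarith)) (Real.exp_pos _).le
  · have hlow : v * Real.exp (-v) ≤ 1 - Real.exp (-v) := by
      have h1 := Real.add_one_le_exp v
      have h2 : Real.exp v * Real.exp (-v) = 1 := by rw [← Real.exp_add]; simp
      nlinarith [Real.exp_pos (-v)]
    have h3 := Real.rpow_le_rpow_of_nonpos (mul_pos hv (Real.exp_pos (-v))) hlow
      (neg_nonpos.2 hq)
    rw [Real.mul_rpow hv.le (Real.exp_pos _).le, ← Real.exp_mul] at h3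
    have hX := Real.rpow_pos_of_pos hv (-q)
    calc _ ≤ Real.exp (-(j * v)) * (v ^ (-q) * Real.exp (-v * -q)) :=
          mul_le_mul_of_nonneg_left h3 (Real.exp_pos _).le
      _ = v ^ (-q) * Real.exp (-((j - q) * v)) := by
          rw [mul_left_comm, ← Real.exp_add]; congr 2; ring
      _ ≤ v ^ (-q) * 1 := by
          refine mul_le_mul_of_nonneg_left (Real.exp_le_one_iff.2 ?_) hX.le
          nlinarith
      _ = _ := mul_one _

lemma abs_exp_mul_rpow_sub_rpow_le {v q j c : ℝ} (hv : 0 < v) (hq : 0 ≤ q) (hqj : q ≤ j)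
    (hc : 0 ≤ c) :
    |Real.exp (c * v) * (Real.exp (-(j * v)) * (1 - Real.exp (-v)) ^ (-q)) - v ^ (-q)| ≤
      (c + j) * v ^ (1 - q) * Real.exp (c * v) := by
  obtain ⟨hlo, hhi⟩ := exp_neg_mul_rpow_bounds hv hq hqj
  have hX := Real.rpow_pos_of_pos hv (-q)
  have hpow : v ^ (1 - q) = v * v ^ (-q) := by
    rw [sub_eq_add_neg, Real.rpow_add hv, Real.rpow_one]
  rw [hpow]
  set A := Real.exp (-(j * v)) * (1 - Real.exp (-v)) ^ (-q)
  set X := v ^ (-q)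
  have hE := Real.exp_pos (c * v)
  have hE1 : 1 ≤ Real.exp (c * v) := Real.one_le_exp (by positivity)
  have hEc : Real.exp (c * v) - 1 ≤ c * v * Real.exp (c * v) := by
    have h1 := Real.add_one_le_exp (-(c * v))
    have h2 : Real.exp (c * v) * Real.exp (-(c * v)) = 1 := by rw [← Real.exp_add]; simp
    nlinarith
  have hJ : 1 - Real.exp (-(j * v)) ≤ j * v := one_sub_exp_neg_le _
  have hj : 0 ≤ j := hq.trans hqj
  have hEX := mul_pos hE hX
  rw [abs_le]
  constructor
  · have h1 : X - Real.exp (c * v) * A ≤ Real.exp (c * v) * X * (1 - Real.exp (-(j * v))) := by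
      nlinarith
    have h2 := mul_le_mul_of_nonneg_left hJ hEX.le
    have h3 : 0 ≤ c * v * (Real.exp (c * v) * X) := by positivity
    nlinarith
  · have h1 : Real.exp (c * v) * A - X ≤ (Real.exp (c * v) - 1) * X := by nlinarith
    have h2 := mul_le_mul_of_nonneg_right hEc hX.le
    have h3 : 0 ≤ j * v * (Real.exp (c * v) * X) := by positivity
    nlinarith

/-- The derivative of `v ↦ e ^ (c v) (1 - e ^ (-v)) ^ k - v ^ k`. -/
noncomputable def kernelDiffDeriv (k c v : ℝ) : ℝ :=
  Real.exp (c * v) * (c * (1 - Real.exp (-v)) ^ k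
    + k * (1 - Real.exp (-v)) ^ (k - 1) * Real.exp (-v)) - k * v ^ (k - 1)

/-- The second derivative of `v ↦ e ^ (c v) (1 - e ^ (-v)) ^ k - v ^ k`. -/
noncomputable def kernelDiffDeriv₂ (k c v : ℝ) : ℝ :=
  Real.exp (c * v) * (c ^ 2 * (1 - Real.exp (-v)) ^ k
    + (2 * c - 1) * k * (1 - Real.exp (-v)) ^ (k - 1) * Real.exp (-v)
    + k * (k - 1) * (1 - Real.exp (-v)) ^ (k - 2) * Real.exp (-(2 * v)))
    - k * (k - 1) * v ^ (k - 2)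

lemma hasDerivAt_one_sub_exp_neg_rpow {v : ℝ} (p : ℝ) (hv : 0 < v) :
    HasDerivAt (fun t => (1 - Real.exp (-t)) ^ p)
      (p * (1 - Real.exp (-v)) ^ (p - 1) * Real.exp (-v)) v := by
  have h : HasDerivAt (fun t => 1 - Real.exp (-t)) (Real.exp (-v)) v := by
    simpa using ((hasDerivAt_neg v).exp).const_sub 1
  convert h.rpow_const (p := p) (Or.inl (one_sub_exp_neg_pos hv).ne') using 1
  ring

lemma hasDerivAt_exp_const_mul (c v : ℝ) :
    HasDerivAt (fun t => Real.exp (c * t)) (c * Real.exp (c * v)) v := by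
  simpa [mul_comm] using ((hasDerivAt_id v).const_mul c).exp

lemma hasDerivAt_kernelDiff {k v : ℝ} (c : ℝ) (hv : 0 < v) :
    HasDerivAt (fun t => Real.exp (c * t) * (1 - Real.exp (-t)) ^ k - t ^ k)
      (kernelDiffDeriv k c v) v := by
  refine (((hasDerivAt_exp_const_mul c v).mul (hasDerivAt_one_sub_exp_neg_rpow k hv)).sub
    (Real.hasDerivAt_rpow_const (p := k) (Or.inl hv.ne'))).congr_deriv ?_
  simp only [kernelDiffDeriv]; ring

lemma hasDerivAt_kernelDiffDeriv {k v : ℝ} (c : ℝ) (hv : 0 < v) :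
    HasDerivAt (kernelDiffDeriv k c) (kernelDiffDeriv₂ k c v) v := by
  have he : HasDerivAt (fun t : ℝ => Real.exp (-t)) (-Real.exp (-v)) v := by
    simpa using (hasDerivAt_neg v).exp
  have h2 : Real.exp (-(2 * v)) = Real.exp (-v) * Real.exp (-v) := by
    rw [← Real.exp_add]; congr 1; ring
  have hw := one_sub_exp_neg_pos hv
  have h := ((hasDerivAt_exp_const_mul c v).mul
      (((hasDerivAt_one_sub_exp_neg_rpow k hv).const_mul c).add
        (((hasDerivAt_one_sub_exp_neg_rpow (k - 1) hv).const_mul k).mul he))).sub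
    ((Real.hasDerivAt_rpow_const (p := k - 1) (Or.inl hv.ne')).const_mul k)
  refine h.congr_deriv ?_
  simp only [kernelDiffDeriv₂, h2, Pi.add_apply, Pi.mul_apply]
  rw [show k - 1 - 1 = k - 2 by ring]
  ring

lemma abs_kernelDiffDeriv₂_le {k c v : ℝ} (hk0 : 0 < k) (hk1 : k ≤ 1) (hc : 0 ≤ c)
    (hv : 0 < v) :
    |kernelDiffDeriv₂ k c v| ≤
      (c ^ 2 + 3 * c + 3) * (1 + v ^ (k - 1)) * Real.exp (c * v) := by
  have hw := one_sub_exp_neg_pos hv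
  have hE := Real.exp_pos (c * v)
  have hX := Real.rpow_pos_of_pos hv (k - 1)
  have hwk : (1 - Real.exp (-v)) ^ k ≤ 1 :=
    Real.rpow_le_one hw.le (by linarith [Real.exp_pos (-v)]) hk0.le
  have hwk0 := Real.rpow_nonneg hw.le k
  have hw1 := (exp_neg_mul_rpow_bounds (q := 1 - k) (j := 1) hv (by linarith) (by linarith)).2
  rw [neg_sub, one_mul] at hw1
  have hw10 : 0 ≤ Real.exp (-v) * (1 - Real.exp (-v)) ^ (k - 1) :=
    mul_nonneg (Real.exp_pos _).le (Real.rpow_nonneg hw.le _)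
  have hw2 := abs_exp_mul_rpow_sub_rpow_le (q := 2 - k) (j := 2) hv (by linarith)
    (by linarith) hc
  rw [neg_sub, show 1 - (2 - k) = k - 1 by ring] at hw2
  have hdecomp : kernelDiffDeriv₂ k c v =
      c ^ 2 * (Real.exp (c * v) * (1 - Real.exp (-v)) ^ k)
      + (2 * c - 1) * k * (Real.exp (c * v) * (Real.exp (-v) * (1 - Real.exp (-v)) ^ (k - 1)))
      + k * (k - 1) * (Real.exp (c * v) *
        (Real.exp (-(2 * v)) * (1 - Real.exp (-v)) ^ (k - 2)) - v ^ (k - 2)) := by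
    simp only [kernelDiffDeriv₂]; ring
  have b1 : |c ^ 2 * (Real.exp (c * v) * (1 - Real.exp (-v)) ^ k)| ≤
      c ^ 2 * Real.exp (c * v) := by
    rw [abs_of_nonneg (by positivity)]
    exact mul_le_mul_of_nonneg_left (mul_le_of_le_one_right hE.le hwk) (by positivity)
  have b2 : |(2 * c - 1) * k *
      (Real.exp (c * v) * (Real.exp (-v) * (1 - Real.exp (-v)) ^ (k - 1)))| ≤
      (2 * c + 1) * (Real.exp (c * v) * v ^ (k - 1)) := by
    rw [abs_mul, abs_of_nonneg (mul_nonneg hE.le hw10)]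
    refine mul_le_mul ?_ (mul_le_mul_of_nonneg_left hw1 hE.le) (mul_nonneg hE.le hw10)
      (by positivity)
    rw [abs_mul, abs_of_pos hk0]
    have : |2 * c - 1| ≤ 2 * c + 1 := abs_le.2 ⟨by linarith, by linarith⟩
    nlinarith [abs_nonneg (2 * c - 1)]
  have b3 : |k * (k - 1) * (Real.exp (c * v) *
        (Real.exp (-(2 * v)) * (1 - Real.exp (-v)) ^ (k - 2)) - v ^ (k - 2))| ≤
      1 * ((c + 2) * v ^ (k - 1) * Real.exp (c * v)) := by
    rw [abs_mul]
    refine mul_le_mul ?_ hw2 (abs_nonneg _) zero_le_one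
    exact abs_le.2 ⟨by nlinarith, by nlinarith⟩
  rw [hdecomp]
  refine (abs_add_three _ _ _).trans ((add_le_add_three b1 b2 b3).trans ?_)
  have : 0 ≤ Real.exp (c * v) * v ^ (k - 1) := by positivity
  nlinarith [mul_nonneg hc hE.le, mul_nonneg (mul_nonneg hc hc) this]

lemma intervalIntegrable_kernelDiffDeriv₂ {k c x : ℝ} (hk0 : 0 < k) (hk1 : k ≤ 1) (hc : 0 ≤ c)
    (hx : 0 ≤ x) : IntervalIntegrable (kernelDiffDeriv₂ k c) volume 0 x := by
  have hdom : IntervalIntegrable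
      (fun v : ℝ => (c ^ 2 + 3 * c + 3) * (1 + v ^ (k - 1)) * Real.exp (c * v)) volume 0 x := by
    refine IntervalIntegrable.mul_continuousOn (IntervalIntegrable.const_mul ?_ _)
      (Continuous.continuousOn (by fun_prop))
    exact intervalIntegrable_const.add
      (intervalIntegral.intervalIntegrable_rpow' (by linarith))
  refine hdom.mono_fun ?_ ?_
  · refine Measurable.aestronglyMeasurable ?_
    unfold kernelDiffDeriv₂
    fun_prop
  · rw [Set.uIoc_of_le hx]
    filter_upwards [self_mem_ae_restrict measurableSet_Ioc] with v hv
    rw [Real.norm_eq_abs, Real.norm_eq_abs]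
    exact (abs_kernelDiffDeriv₂_le hk0 hk1 hc hv.1).trans (le_abs_self _)

lemma tendsto_kernelDiffDeriv_zero {k c : ℝ} (hk0 : 0 < k) (hk1 : k ≤ 1) (hc : 0 ≤ c) :
    Tendsto (kernelDiffDeriv k c) (𝓝[>] 0) (𝓝 0) := by
  have hmaj : Tendsto (fun v : ℝ => c * Real.exp (c * v) * (1 - Real.exp (-v)) ^ k
      + k * ((c + 1) * v ^ k * Real.exp (c * v))) (𝓝[>] 0) (𝓝 0) := by
    have hcont : Continuous (fun v : ℝ => c * Real.exp (c * v) * (1 - Real.exp (-v)) ^ k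
        + k * ((c + 1) * v ^ k * Real.exp (c * v))) := by
      have h1 : Continuous fun v : ℝ => (1 - Real.exp (-v)) ^ k :=
        Continuous.rpow_const (by fun_prop) fun _ => Or.inr hk0.le
      have h2 : Continuous fun v : ℝ => v ^ k :=
        Continuous.rpow_const (by fun_prop) fun _ => Or.inr hk0.le
      fun_prop
    have := (hcont.tendsto 0).mono_left (nhdsWithin_le_nhds (s := Set.Ioi 0))
    simpa [Real.zero_rpow hk0.ne'] using this
  refine squeeze_zero_norm' ?_ hmaj
  filter_upwards [self_mem_nhdsWithin] with v hv
  have hv : 0 < v := hv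
  have h := abs_exp_mul_rpow_sub_rpow_le (q := 1 - k) (j := 1) hv (by linarith)
    (by linarith) hc
  rw [neg_sub, sub_sub_cancel, one_mul] at h
  have hdecomp : kernelDiffDeriv k c v = c * Real.exp (c * v) * (1 - Real.exp (-v)) ^ k
      + k * (Real.exp (c * v) * (Real.exp (-v) * (1 - Real.exp (-v)) ^ (k - 1))
        - v ^ (k - 1)) := by
    simp only [kernelDiffDeriv]; ring
  rw [hdecomp, Real.norm_eq_abs]
  refine (abs_add_le _ _).trans (add_le_add (le_of_eq (abs_of_nonneg ?_)) ?_)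
  · have := Real.rpow_nonneg (one_sub_exp_neg_pos hv).le k
    positivity
  · rw [abs_mul, abs_of_pos hk0]
    exact mul_le_mul_of_nonneg_left h hk0.le

/-- Taylor's formula of second order at the singular point `0`. -/
lemma integral_sub_mul_kernelDiffDeriv₂ {k c s : ℝ} (hk0 : 0 < k) (hk1 : k ≤ 1) (hc : 0 ≤ c)
    (hs : 0 < s) :
    ∫ v in (0 : ℝ)..s, kernelDiffDeriv₂ k c v * (s - v) =
      Real.exp (c * s) * (1 - Real.exp (-s)) ^ k - s ^ k := by
  have hcont : Continuous fun t : ℝ => Real.exp (c * t) * (1 - Real.exp (-t)) ^ k - t ^ k := by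
    have h1 : Continuous fun v : ℝ => (1 - Real.exp (-v)) ^ k :=
      Continuous.rpow_const (by fun_prop) fun _ => Or.inr hk0.le
    have h2 : Continuous fun v : ℝ => v ^ k :=
      Continuous.rpow_const (by fun_prop) fun _ => Or.inr hk0.le
    fun_prop
  have hlin : Continuous fun t : ℝ => s - t := by fun_prop
  rw [intervalIntegral.integral_eq_sub_of_hasDerivAt_of_tendsto hs
    (f := fun t => kernelDiffDeriv k c t * (s - t)
      + (Real.exp (c * t) * (1 - Real.exp (-t)) ^ k - t ^ k)) (fa := 0)
    (fb := Real.exp (c * s) * (1 - Real.exp (-s)) ^ k - s ^ k), sub_zero]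
  · intro v hv
    refine (((hasDerivAt_kernelDiffDeriv c hv.1).mul
      ((hasDerivAt_id v).const_sub s)).add (hasDerivAt_kernelDiff c hv.1)).congr_deriv ?_
    simp
  · exact (intervalIntegrable_kernelDiffDeriv₂ hk0 hk1 hc hs.le).mul_continuousOn
      hlin.continuousOn
  · have h := ((tendsto_kernelDiffDeriv_zero hk0 hk1 hc).mul
      ((hlin.tendsto 0).mono_left nhdsWithin_le_nhds)).add
      ((hcont.tendsto 0).mono_left nhdsWithin_le_nhds)
    simpa [Real.zero_rpow hk0.ne'] using h
  · have h := (((hasDerivAt_kernelDiffDeriv (k := k) c hs).continuousAt.tendsto.mul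
      (hlin.tendsto s)).add (hcont.tendsto s)).mono_left (nhdsWithin_le_nhds (s := Set.Iio s))
    simpa using h

lemma integral_kernelDiffDeriv₂_mul_posPart {k c l x : ℝ} (hk0 : 0 < k) (hk1 : k ≤ 1)
    (hc : 0 ≤ c) (hl : 0 ≤ l) (hlx : l < x) :
    ∫ v in (0 : ℝ)..x, kernelDiffDeriv₂ k c v * max (x - v - l) 0 =
      Real.exp (c * (x - l)) * (1 - Real.exp (l - x)) ^ k - (x - l) ^ k := by
  have hs : 0 < x - l := sub_pos.2 hlx
  have hx : 0 ≤ x := hl.trans hlx.le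
  have hint : IntervalIntegrable (fun v => kernelDiffDeriv₂ k c v * max (x - v - l) 0)
      volume 0 x :=
    (intervalIntegrable_kernelDiffDeriv₂ hk0 hk1 hc hx).mul_continuousOn
      (Continuous.continuousOn (by fun_prop))
  have htail : ∫ v in (x - l)..x, kernelDiffDeriv₂ k c v * max (x - v - l) 0 = 0 := by
    rw [intervalIntegral.integral_congr (g := fun _ => (0 : ℝ))]
    · simp
    · intro v hv
      rw [Set.uIcc_of_le (by linarith)] at hv
      have : max (x - v - l) 0 = 0 := max_eq_right (by linarith [hv.1])
      simp [this]
  rw [← intervalIntegral.integral_add_adjacent_intervals (b := x - l)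
    (hint.mono_set (by
      rw [Set.uIcc_of_le hs.le, Set.uIcc_of_le hx]
      exact Set.Icc_subset_Icc_right (by linarith)))
    (hint.mono_set (by
      rw [Set.uIcc_of_le (by linarith), Set.uIcc_of_le hx]
      exact Set.Icc_subset_Icc_left hs.le)), htail, add_zero]
  rw [← neg_sub x l, ← integral_sub_mul_kernelDiffDeriv₂ hk0 hk1 hc hs]
  apply intervalIntegral.integral_congr
  intro v hv
  rw [Set.uIcc_of_le hs.le] at hv
  simp only
  rw [max_eq_left (by linarith [hv.2])]
  ring

lemma exists_integral_exp_mul_one_add_rpow_le {k δ : ℝ} (hk0 : 0 < k) (hk1 : k ≤ 1)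
    (hδ : 0 < δ) :
    ∃ J : ℝ, 0 ≤ J ∧ ∀ x : ℝ, 0 ≤ x →
      ∫ v in (0 : ℝ)..x, (1 + v ^ (k - 1)) * Real.exp (-δ * (x - v)) ≤ J := by
  obtain ⟨D, hD, hexp⟩ := exists_integral_rpow_mul_exp_le (p := 0) (by norm_num) hδ
  obtain ⟨G, hG, hgam⟩ := exists_integral_rpow_mul_exp_le (p := k - 1) (b := 1) (by linarith)
    one_pos
  refine ⟨2 * D + Real.exp 1 * G, by positivity, fun x hx => ?_⟩
  have hpow : IntervalIntegrable (fun v : ℝ => v ^ (k - 1)) volume 0 x :=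
    intervalIntegral.intervalIntegrable_rpow' (by linarith)
  have hi1 : IntervalIntegrable (fun v : ℝ => 2 * Real.exp (-δ * (x - v))) volume 0 x :=
    Continuous.intervalIntegrable (by fun_prop) _ _
  have hi2 : IntervalIntegrable
      (fun v : ℝ => Real.exp 1 * (v ^ (k - 1) * Real.exp (-1 * v))) volume 0 x :=
    (intervalIntegrable_rpow_mul_exp (by linarith) x).const_mul _
  have hsub := intervalIntegral.integral_comp_sub_left (a := 0) (b := x)
    (fun v : ℝ => v ^ (0 : ℝ) * Real.exp (-δ * v)) x
  rw [sub_self, sub_zero] at hsub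
  calc _ ≤ ∫ v in (0 : ℝ)..x, (2 * Real.exp (-δ * (x - v))
        + Real.exp 1 * (v ^ (k - 1) * Real.exp (-1 * v))) := by
        refine intervalIntegral.integral_mono_on_of_le_Ioo hx
          ((intervalIntegrable_const.add hpow).mul_continuousOn
            (Continuous.continuousOn (by fun_prop))) (hi1.add hi2) fun v hv => ?_
        have hv0 : 0 < v := hv.1
        have hX := Real.rpow_pos_of_pos hv0 (k - 1)
        have hE := Real.exp_pos (-δ * (x - v))
        have hE1 : Real.exp (-δ * (x - v)) ≤ 1 := by
          rw [Real.exp_le_one_iff]; nlinarith [hv.2]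
        have hrw : Real.exp 1 * (v ^ (k - 1) * Real.exp (-1 * v)) =
            v ^ (k - 1) * Real.exp (1 - v) := by
          rw [mul_left_comm, ← Real.exp_add]; congr 2; ring
        rw [hrw]
        rcases le_total v 1 with h | h
        · have : 1 ≤ Real.exp (1 - v) := Real.one_le_exp (by linarith)
          nlinarith
        · have h1 : v ^ (k - 1) ≤ 1 := Real.rpow_le_one_of_one_le_of_nonpos h (by linarith)
          have : 0 < v ^ (k - 1) * Real.exp (1 - v) := by positivity
          nlinarith
    _ = 2 * (∫ v in (0 : ℝ)..x, v ^ (0 : ℝ) * Real.exp (-δ * v))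
        + Real.exp 1 * ∫ v in (0 : ℝ)..x, v ^ (k - 1) * Real.exp (-1 * v) := by
        rw [intervalIntegral.integral_add hi1 hi2, intervalIntegral.integral_const_mul,
          intervalIntegral.integral_const_mul, ← hsub]
        simp
    _ ≤ _ := add_le_add (mul_le_mul_of_nonneg_left (hexp x hx) zero_le_two)
        (mul_le_mul_of_nonneg_left (hgam x hx) (Real.exp_pos 1).le)

lemma rpow_le_const_mul_exp {k δ y : ℝ} (hk0 : 0 < k) (hk1 : k ≤ 1) (hδ : 0 < δ) (hy : 0 ≤ y) :
    y ^ k ≤ (1 + 1 / δ) * Real.exp (δ * y) := by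
  have h1 : y ^ k ≤ 1 + y := by
    calc y ^ k ≤ (1 + y) ^ k := Real.rpow_le_rpow hy (by linarith) hk0.le
      _ ≤ (1 + y) ^ (1 : ℝ) := Real.rpow_le_rpow_of_exponent_le (by linarith) hk1
      _ = 1 + y := Real.rpow_one _
  have h2 : 1 ≤ Real.exp (δ * y) := Real.one_le_exp (by positivity)
  have h3 : y ≤ 1 / δ * Real.exp (δ * y) := by
    rw [div_mul_eq_mul_div, one_mul, le_div_iff₀ hδ]
    linarith [Real.add_one_le_exp (δ * y)]
  linarith

/-- The translation bound for finite sums, with Riesz sums written via truncated powers. -/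
lemma exists_norm_sum_exp_kernel_le {k u ε : ℝ} (hk0 : 0 < k) (hk1 : k ≤ 1) (hu : 0 < u)
    (hε : 0 < ε) :
    ∃ C : ℝ, 0 < C ∧ ∀ (N : Finset ℕ) (Λ : ℕ → ℝ) (a : ℕ → ℂ) (x M : ℝ), 0 < x → 0 ≤ M →
      (∀ n, 0 ≤ Λ n) → (∀ n ∈ N, Λ n < x) →
      (∀ y, 0 < y → y ≤ x → ‖∑ n ∈ N, a n * (((max (y - Λ n) 0) ^ k : ℝ) : ℂ)‖ ≤
        M * (y ^ k * Real.exp (u * y))) →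
      ‖∑ n ∈ N, a n *
        ((Real.exp (-((u + ε) * Λ n)) * (1 - Real.exp (Λ n - x)) ^ k : ℝ) : ℂ)‖ ≤ C * M := by
  have hδ : 0 < ε / 2 := by positivity
  obtain ⟨D, hD, hone⟩ := exists_norm_riesz_one_le (w := u + ε / 2) hk0 hk1 (by positivity)
  obtain ⟨J, hJ, hexp⟩ := exists_integral_exp_mul_one_add_rpow_le hk0 hk1 hδ
  set c := u + ε with hc_def
  have hc : 0 ≤ c := by positivity
  set A := c ^ 2 + 3 * c + 3 with hA_def
  have hA : 0 ≤ A := by positivity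
  refine ⟨(1 + 1 / (ε / 2)) * (1 + A * D * J), by positivity,
    fun N Λ a x M hx hM hΛ hN h => ?_⟩
  set K := M * (1 + 1 / (ε / 2)) with hK_def
  have hK : 0 ≤ K := by positivity
  have hk : ∀ y, 0 ≤ y → y ≤ x → ‖∑ n ∈ N, a n * (((max (y - Λ n) 0) ^ k : ℝ) : ℂ)‖ ≤
      K * Real.exp ((u + ε / 2) * y) := by
    intro y hy hyx
    rcases hy.eq_or_lt with rfl | hy
    · rw [Finset.sum_eq_zero]
      · rw [norm_zero]; positivity
      · intro n _
        rw [max_eq_right (by linarith [hΛ n]), Real.zero_rpow hk0.ne']; simp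
    · refine (h y hy hyx).trans ?_
      rw [hK_def, mul_assoc]
      refine mul_le_mul_of_nonneg_left ?_ hM
      have := mul_le_mul_of_nonneg_right (rpow_le_const_mul_exp hk0 hk1 hδ hy.le)
        (Real.exp_pos (u * y)).le
      rwa [mul_assoc, ← Real.exp_add, show ε / 2 * y + u * y = (u + ε / 2) * y by ring] at this
  have hS1 := hone N Λ a x K hΛ hk
  have hH := intervalIntegrable_kernelDiffDeriv₂ hk0 hk1 hc hx.le
  have hrep : ∑ n ∈ N, a n *
        ((Real.exp (-(c * Λ n)) * (1 - Real.exp (Λ n - x)) ^ k : ℝ) : ℂ) =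
      (Real.exp (-(c * x)) : ℂ) * (∑ n ∈ N, a n * (((max (x - Λ n) 0) ^ k : ℝ) : ℂ) +
        ∫ v in (0 : ℝ)..x, (kernelDiffDeriv₂ k c v : ℂ) *
          ∑ n ∈ N, a n * ((max (x - v - Λ n) 0 : ℝ) : ℂ)) := by
    rw [← sum_mul_integral_eq N a (kernelDiffDeriv₂ k c) (fun n v => max (x - v - Λ n) 0) x
      (fun n _ => hH.mul_continuousOn (Continuous.continuousOn (by fun_prop))),
      ← Finset.sum_add_distrib, Finset.mul_sum]
    refine Finset.sum_congr rfl fun n hn => ?_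
    rw [integral_kernelDiffDeriv₂_mul_posPart hk0 hk1 hc (hΛ n) (hN n hn),
      max_eq_left (by linarith [hN n hn]),
      show -(c * Λ n) = -(c * x) + c * (x - Λ n) by ring, Real.exp_add]
    push_cast; ring
  have hint : ‖∫ v in (0 : ℝ)..x, (kernelDiffDeriv₂ k c v : ℂ) *
          ∑ n ∈ N, a n * ((max (x - v - Λ n) 0 : ℝ) : ℂ)‖ ≤
      A * D * K * Real.exp (c * x) * J := by
    calc _ ≤ ∫ v in (0 : ℝ)..x, A * D * K * Real.exp (c * x) *
          ((1 + v ^ (k - 1)) * Real.exp (-(ε / 2) * (x - v))) := by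
          refine intervalIntegral.norm_integral_le_of_norm_le hx.le
            (ae_of_all _ fun v hv => ?_) ?_
          · rw [norm_mul, Complex.norm_real, Real.norm_eq_abs]
            have h1 := abs_kernelDiffDeriv₂_le hk0 hk1 hc hv.1
            have h2 := hS1 (x - v) (by linarith [hv.2]) (by linarith [hv.1])
            have h3 : Real.exp (c * v) * Real.exp ((u + ε / 2) * (x - v)) =
                Real.exp (c * x) * Real.exp (-(ε / 2) * (x - v)) := by
              rw [← Real.exp_add, ← Real.exp_add, hc_def]; congr 1; ring
            refine (mul_le_mul h1 h2 (norm_nonneg _) ((abs_nonneg _).trans h1)).trans_eq ?_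
            rw [← hA_def]
            linear_combination (A * (1 + v ^ (k - 1)) * D * K) * h3
          · exact ((intervalIntegrable_const.add
              (intervalIntegral.intervalIntegrable_rpow' (by linarith))).mul_continuousOn
                (Continuous.continuousOn (by fun_prop))).const_mul _
      _ ≤ _ := by
          rw [intervalIntegral.integral_const_mul]
          exact mul_le_mul_of_nonneg_left (hexp x hx.le) (by positivity)
  have hkx : ‖∑ n ∈ N, a n * (((max (x - Λ n) 0) ^ k : ℝ) : ℂ)‖ ≤ K * Real.exp (c * x) := by
    refine (hk x hx.le le_rfl).trans (mul_le_mul_of_nonneg_left (Real.exp_le_exp.2 ?_) hK)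
    rw [hc_def]; nlinarith
  rw [hrep, norm_mul, Complex.norm_real, Real.norm_of_nonneg (Real.exp_pos _).le]
  calc _ ≤ Real.exp (-(c * x)) *
        (K * Real.exp (c * x) + A * D * K * Real.exp (c * x) * J) :=
        mul_le_mul_of_nonneg_left ((norm_add_le _ _).trans (add_le_add hkx hint))
          (Real.exp_pos _).le
    _ = (Real.exp (-(c * x)) * Real.exp (c * x)) * (K * (1 + A * D * J)) := by ring
    _ = _ := by rw [← Real.exp_add, neg_add_cancel, Real.exp_zero, hK_def]; ring

/-- Abel-type bound for translated second Riesz means by first Riesz means: for `0 < k ≤ 1`,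
`u > 0`, `ε > 0` there is `C = C(k,u,ε)` such that for every frequency `λ`, every `x > 0`
and every complex sequence `(a_n)`,
`|∑_{λ_n<x} a_n e^{-(u+ε)λ_n}(1 − e^{λ_n − x})^k| ≤ C sup_{0<y≤x} |e^{-uy} ∑_{λ_n<y} a_n (1 − λ_n/y)^k|`. -/
theorem riesz_abel_translation_bound_second
    (k u ε : ℝ) (hk0 : 0 < k) (hk1 : k ≤ 1) (hu : 0 < u) (hε : 0 < ε) :
    ∃ C : ℝ, 0 < C ∧ ∀ (Λ : ℕ → ℝ), IsFrequency Λ → ∀ x : ℝ, 0 < x → ∀ a : ℕ → ℂ,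
      (‖∑' n : ℕ, if Λ n < x then
            a n * ((Real.exp (-((u + ε) * Λ n)) * (1 - Real.exp (Λ n - x)) ^ k : ℝ) : ℂ)
          else 0‖₊ : ℝ≥0∞) ≤
        ENNReal.ofReal C * ⨆ (y : ℝ) (_ : 0 < y) (_ : y ≤ x),
          (‖(Real.exp (-(u * y)) : ℂ) *
              ∑' n : ℕ, if Λ n < y then a n * (((1 - Λ n / y) ^ k : ℝ) : ℂ) else 0‖₊ : ℝ≥0∞) := by
  obtain ⟨C, hC, hmain⟩ := exists_norm_sum_exp_kernel_le hk0 hk1 hu hε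
  refine ⟨C, hC, fun Λ hΛ x hx a => ?_⟩
  have hfin : {n | Λ n < x}.Finite := by
    obtain ⟨m, hm⟩ := (hΛ.unbounded.eventually_ge_atTop x).exists_forall_of_atTop
    exact (Set.finite_lt_nat m).subset fun n hn => by
      by_contra hnm
      exact absurd (hm n (not_lt.1 hnm)) (not_le.2 hn)
  set N := hfin.toFinset with hN_def
  have hN : ∀ n, n ∈ N ↔ Λ n < x := fun n => by simp [hN_def]
  set S : ℝ≥0∞ := ⨆ (y : ℝ) (_ : 0 < y) (_ : y ≤ x), (‖(Real.exp (-(u * y)) : ℂ) *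
    ∑' n : ℕ, if Λ n < y then a n * (((1 - Λ n / y) ^ k : ℝ) : ℂ) else 0‖₊ : ℝ≥0∞) with hS_def
  rcases eq_or_ne S ⊤ with hS | hS
  · rw [hS, ENNReal.mul_top (by simpa using hC)]
    exact le_top
  have hlhs : (∑' n : ℕ, if Λ n < x then
      a n * ((Real.exp (-((u + ε) * Λ n)) * (1 - Real.exp (Λ n - x)) ^ k : ℝ) : ℂ) else 0) =
      ∑ n ∈ N, a n *
        ((Real.exp (-((u + ε) * Λ n)) * (1 - Real.exp (Λ n - x)) ^ k : ℝ) : ℂ) := by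
    rw [tsum_eq_sum (s := N) fun n hn => if_neg (mt (hN n).2 hn)]
    exact Finset.sum_congr rfl fun n hn => if_pos ((hN n).1 hn)
  have hriesz : ∀ y, 0 < y → y ≤ x →
      ∑ n ∈ N, a n * (((max (y - Λ n) 0) ^ k : ℝ) : ℂ) = ((y ^ k : ℝ) : ℂ) *
        ∑' n : ℕ, if Λ n < y then a n * (((1 - Λ n / y) ^ k : ℝ) : ℂ) else 0 := by
    intro y hy hyx
    rw [tsum_eq_sum (s := N) fun n hn =>
      if_neg fun hlt => hn ((hN n).2 (hlt.trans_le hyx)), Finset.mul_sum]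
    refine Finset.sum_congr rfl fun n _ => ?_
    split_ifs with hlt
    · have h1 : y - Λ n = y * (1 - Λ n / y) := by field_simp
      have h2 : 0 ≤ 1 - Λ n / y := by
        rw [sub_nonneg, div_le_one hy]; exact hlt.le
      rw [max_eq_left (by linarith), h1, Real.mul_rpow hy.le h2]
      push_cast; ring
    · rw [max_eq_right (by linarith), Real.zero_rpow hk0.ne']; simp
  have hbound := hmain N Λ a x S.toReal hx ENNReal.toReal_nonneg hΛ.nonneg
    (fun n hn => (hN n).1 hn) (by
      intro y hy hyx
      have hle : (‖(Real.exp (-(u * y)) : ℂ) * ∑' n : ℕ,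
          if Λ n < y then a n * (((1 - Λ n / y) ^ k : ℝ) : ℂ) else 0‖₊ : ℝ≥0∞) ≤ S :=
        le_iSup_of_le y (le_iSup_of_le hy (le_iSup_of_le hyx le_rfl))
      have hle' := ENNReal.toReal_mono hS hle
      rw [ENNReal.coe_toReal, coe_nnnorm, norm_mul, Complex.norm_real,
        Real.norm_of_nonneg (Real.exp_pos _).le] at hle'
      have hyk := Real.rpow_nonneg hy.le k
      rw [hriesz y hy hyx, norm_mul, Complex.norm_real, Real.norm_of_nonneg hyk]
      have hcancel : Real.exp (u * y) * Real.exp (-(u * y)) = 1 := by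
        rw [← Real.exp_add, add_neg_cancel, Real.exp_zero]
      have := mul_le_mul_of_nonneg_left hle' (mul_nonneg hyk (Real.exp_pos (u * y)).le)
      rw [← mul_assoc, mul_assoc (y ^ k), hcancel, mul_one] at this
      linarith)
  rw [hlhs]
  have hcoe : (‖∑ n ∈ N, a n * ((Real.exp (-((u + ε) * Λ n)) *
      (1 - Real.exp (Λ n - x)) ^ k : ℝ) : ℂ)‖₊ : ℝ≥0∞) = ENNReal.ofReal ‖∑ n ∈ N, a n *
      ((Real.exp (-((u + ε) * Λ n)) * (1 - Real.exp (Λ n - x)) ^ k : ℝ) : ℂ)‖ :=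
    (ofReal_norm _).symm
  rw [hcoe]
  refine (ENNReal.ofReal_le_ofReal hbound).trans_eq ?_
  rw [ENNReal.ofReal_mul hC.le, ENNReal.ofReal_toReal hS]
end
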